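/- arXiv:2403.11601 — 2 statements merged into one kernel-verified Lean document; each statement's English description precedes it below -/
import Mathlib

section
/- Let B be a real normed space, and let Tr_i, Tr_e : W → B and ∂_i, ∂_e : U → B* be linear maps, where U, W are real vector spaces. Let D : B → W and S : B* → U be linear maps satisfying, for all f ∈ B and g ∈ B*: (1) Tr_i(D f) − Tr_e(D f) = −f; (2) ∂_i(S g) − ∂_e(S g) = g; (3) the orthogonality identity (∂_i(S g))(Tr_i(D f)) = (∂_e(S g))(Tr_e(D f)). Define 𝒦 : B → B by 𝒦 := ½(Tr_i + Tr_e) ∘ D. Then Tr_i ∘ D = −½ I + 𝒦 and Tr_e ∘ D = ½ I + 𝒦, and for all f ∈ B, g ∈ B*: g(𝒦 f) = ½ ((∂_i + ∂_e)(S g))(f); that is, the dual operator 𝒦* satisfies 𝒦* = ½(∂_i + ∂_e) ∘ S. -/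
/-- Jump relations for the Neumann–Poincaré operator. Given linear maps
`Tr_i, Tr_e : W → B`, `∂_i, ∂_e : U → B*`, `D : B → W`, `S : B* → U` satisfying
(1) `Tr_i (D f) − Tr_e (D f) = −f`, (2) `∂_i (S g) − ∂_e (S g) = g`, and
(3) `(∂_i (S g))(Tr_i (D f)) = (∂_e (S g))(Tr_e (D f))`, the operator
`𝒦 := ½ (Tr_i + Tr_e) ∘ D` satisfies `Tr_i ∘ D = −½ I + 𝒦`, `Tr_e ∘ D = ½ I + 𝒦`
and `g (𝒦 f) = ½ ((∂_i + ∂_e)(S g))(f)`, i.e. `𝒦* = ½ (∂_i + ∂_e) ∘ S`. -/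
theorem stmt10 {B U W : Type*} [NormedAddCommGroup B] [NormedSpace ℝ B]
    [AddCommGroup U] [Module ℝ U] [AddCommGroup W] [Module ℝ W]
    (Tri Tre : W →ₗ[ℝ] B) (di de : U →ₗ[ℝ] (B →L[ℝ] ℝ))
    (D : B →ₗ[ℝ] W) (S : (B →L[ℝ] ℝ) →ₗ[ℝ] U)
    (h1 : ∀ f : B, Tri (D f) - Tre (D f) = -f)
    (h2 : ∀ g : B →L[ℝ] ℝ, di (S g) - de (S g) = g)
    (h3 : ∀ (f : B) (g : B →L[ℝ] ℝ), di (S g) (Tri (D f)) = de (S g) (Tre (D f)))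
    (K : B → B) (hK : ∀ f : B, K f = (1 / 2 : ℝ) • (Tri (D f) + Tre (D f))) :
    (∀ f : B, Tri (D f) = -((1 / 2 : ℝ) • f) + K f) ∧
    (∀ f : B, Tre (D f) = (1 / 2 : ℝ) • f + K f) ∧
    (∀ (f : B) (g : B →L[ℝ] ℝ), g (K f) = (1 / 2 : ℝ) * (di (S g) f + de (S g) f)) := by
  have hTre (f : B) : Tre (D f) = Tri (D f) + f := by
    rw [← sub_eq_iff_eq_add', ← neg_sub, h1, neg_neg]
  refine ⟨fun f => ?_, fun f => ?_, fun f g => ?_⟩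
  · rw [hK, hTre]
    module
  · rw [hK, hTre]
    module
  · have hdi := congrArg (di (S g)) (hTre f)
    have hde := congrArg (de (S g)) (hTre f)
    have hx := DFunLike.congr_fun (h2 g) (Tri (D f))
    have hy := DFunLike.congr_fun (h2 g) (Tre (D f))
    rw [map_add] at hdi hde
    rw [sub_apply] at hx hy
    rw [hK, map_smul, map_add, smul_eq_mul]
    linarith [h3 f g]
end

section
/- Let B be a real normed space and let K : B* → B* and P : B* → B be linear maps such that for every nonzero g ∈ B*: (½ g + K g)(P g) > 0 and (−½ g + K g)(P g) < 0. Then for every real number λ with |λ| ≥ ½, the operator λ I + K : B* → B* is injective. -/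
/-- Let `B` be a real normed space and `K : B* → B*`, `P : B* → B`
linear maps such that for every nonzero `g ∈ B*` one has `(½ g + K g)(P g) > 0` and
`(−½ g + K g)(P g) < 0`. Then for every real `λ` with `|λ| ≥ ½` the operator
`λ I + K` is injective on `B*`. -/
theorem stmt15 {B : Type*} [NormedAddCommGroup B] [NormedSpace ℝ B]
    (K : (B →L[ℝ] ℝ) →ₗ[ℝ] (B →L[ℝ] ℝ)) (P : (B →L[ℝ] ℝ) →ₗ[ℝ] B)
    (hpos : ∀ g : B →L[ℝ] ℝ, g ≠ 0 →
      0 < ((1 / 2 : ℝ) • g + K g) (P g) ∧ ((-(1 / 2) : ℝ) • g + K g) (P g) < 0) :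
    ∀ lam : ℝ, 1 / 2 ≤ |lam| →
      Function.Injective (fun g : B →L[ℝ] ℝ => lam • g + K g) := by
  intro lam hlam g₁ g₂ h
  by_contra hne
  obtain ⟨h₁, h₂⟩ := hpos (g₁ - g₂) (sub_ne_zero.mpr hne)
  have hker : lam • (g₁ - g₂) + K (g₁ - g₂) = 0 := by
    rw [smul_sub, map_sub, sub_add_sub_comm]
    exact sub_eq_zero.mpr h
  have h₀ := DFunLike.congr_fun hker (P (g₁ - g₂))
  generalize g₁ - g₂ = g at h₀ h₁ h₂
  simp only [add_apply, smul_apply, smul_eq_mul,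
    zero_apply] at h₀ h₁ h₂
  rcases le_abs.mp hlam with hl | hl <;> nlinarith
end
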